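/- Fix a prime p and an integer c with 0 < c < p. There exists a countable group G_0 of exponent dividing p and nilpotency class at most c such that every at most countable group of exponent dividing p and nilpotency class at most c admits an injective group homomorphism into G_0. -/

import Mathlib

universe u

/-- A decreasing series `P 1 = G ≥ P 2 ≥ ⋯ ≥ P (c + 1) = 1` of subgroups with
`[P i, P j] ≤ P (i + j)`. -/
structure NSeries (G : Type*) [Group G] (c : ℕ) where
  P : ℕ → Subgroup G
  antitone : Antitone P
  one_eq_top : P 1 = ⊤
  succ_eq_bot : P (c + 1) = ⊥
  commutator_mem : ∀ {i j : ℕ} {x y : G}, x ∈ P i → y ∈ P j → x * y * x⁻¹ * y⁻¹ ∈ P (i + j)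

namespace NSeries

section Basic

variable {G : Type*} [Group G] {c : ℕ} (S : NSeries G c)

lemma mem_one (g : G) : g ∈ S.P 1 := S.one_eq_top ▸ Subgroup.mem_top g

lemma mem_zero (g : G) : g ∈ S.P 0 := S.antitone zero_le_one (S.mem_one g)

lemma eq_one_of_mem {i : ℕ} (hi : c + 1 ≤ i) {g : G} (hg : g ∈ S.P i) : g = 1 :=
  Subgroup.mem_bot.mp (S.succ_eq_bot ▸ S.antitone hi hg)

lemma lowerCentralSeries_le (n : ℕ) :
    Subgroup.lowerCentralSeries (⊤ : Subgroup G) n ≤ S.P (n + 1) := by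
  induction n with
  | zero => simp [S.one_eq_top]
  | succ n ih =>
    rw [Subgroup.lowerCentralSeries_succ, Subgroup.commutator_le]
    intro x hx y _
    exact S.commutator_mem (ih hx) (S.mem_one y)

lemma lowerCentralSeries_eq_bot {G : Type*} [Group G] {c : ℕ} (S : NSeries G c) :
    Subgroup.lowerCentralSeries (⊤ : Subgroup G) c = ⊥ :=
  le_bot_iff.mp (S.succ_eq_bot ▸ S.lowerCentralSeries_le c)

/-- An element outside `M` of maximal weight. -/
lemma exists_maximal_weight {M : Subgroup G} (hM : M ≠ ⊤) :
    ∃ k x, 1 ≤ k ∧ k ≤ c ∧ x ∈ S.P k ∧ x ∉ M ∧ S.P (k + 1) ≤ M := by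
  classical
  have hex : ∃ m, S.P m ≤ M := ⟨c + 1, by simp [S.succ_eq_bot]⟩
  have hle : Nat.find hex ≤ c + 1 := Nat.find_min' hex (by simp [S.succ_eq_bot])
  have hgt : 1 < Nat.find hex := by
    rw [Nat.lt_find_iff]
    intro m hm h
    exact hM (top_le_iff.mp (S.one_eq_top ▸ (S.antitone hm).trans h))
  obtain ⟨x, hx, hxM⟩ := SetLike.not_le_iff_exists.mp
    (Nat.find_min hex (m := Nat.find hex - 1) (by omega))
  refine ⟨Nat.find hex - 1, x, by omega, by omega, hx, hxM, ?_⟩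
  rw [Nat.sub_add_cancel hgt.le]
  exact Nat.find_spec hex

variable {S}

lemma conj_mem {M : Subgroup G} {k : ℕ} {x m : G} (hx : x ∈ S.P k) (hM : S.P (k + 1) ≤ M)
    (hm : m ∈ M) : x * m * x⁻¹ ∈ M := by
  have h := M.mul_mem (hM (S.commutator_mem hx (S.mem_one m))) hm
  simpa using h

lemma exists_eq_mul_pow {M : Subgroup G} {k p : ℕ} (hp : p ≠ 0) {x : G} (hxp : x ^ p = 1)
    (hx : x ∈ S.P k) (hM : S.P (k + 1) ≤ M) {g : G} (hg : g ∈ M ⊔ Subgroup.zpowers x) :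
    ∃ m ∈ M, ∃ n : ℕ, g = m * x ^ n := by
  have hN : Subgroup.zpowers x ≤ Subgroup.normalizer (M : Set G) := by
    rw [Subgroup.zpowers_le, Subgroup.mem_normalizer_iff]
    refine fun h => ⟨fun hh => conj_mem hx hM hh, fun hh => ?_⟩
    have h2 := conj_mem (S := S) (inv_mem hx) hM hh
    simpa [mul_assoc] using h2
  rw [← SetLike.mem_coe, Subgroup.coe_mul_of_right_le_normalizer_left _ _ hN] at hg
  obtain ⟨m, hm, y, hy, rfl⟩ := hg
  have hfin : IsOfFinOrder x := isOfFinOrder_iff_pow_eq_one.mpr ⟨p, Nat.pos_of_ne_zero hp, hxp⟩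
  obtain ⟨n, rfl⟩ := hfin.mem_powers_iff_mem_zpowers.mpr hy
  exact ⟨m, hm, n, rfl⟩

end Basic

end NSeries

lemma dvd_of_pow_mem_of_notMem {G : Type*} [Group G] {p : ℕ} (hp : p.Prime) {M : Subgroup G} {x : G}
    (hx : x ∉ M) (hxp : x ^ p = 1) {n : ℕ} (hn : x ^ n ∈ M) : p ∣ n := by
  by_contra h
  have hc : Nat.Coprime n p := ((Nat.Prime.coprime_iff_not_dvd hp).mpr h).symm
  have h1 : x ^ (Nat.gcd n p : ℤ) ∈ M := by
    rw [Nat.gcd_eq_gcd_ab, zpow_add, zpow_mul, zpow_mul]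
    refine M.mul_mem (M.zpow_mem (by simpa using hn) _) (M.zpow_mem ?_ _)
    simp [hxp]
  rw [hc.gcd_eq_one] at h1
  exact hx (by simpa using h1)

/-- The `j`-th term of the filtration of the group algebra spanned by products
`∏ (gₛ - 1)`, with `gₛ ∈ M` of weights adding up to at least `j`. -/
inductive AugPow (k : Type*) {G : Type*} [Field k] [Group G] (P : ℕ → Subgroup G)
    (M : Subgroup G) : ℕ → MonoidAlgebra k G → Prop
  | zero (j : ℕ) : AugPow k P M j 0
  | add {j : ℕ} {u v : MonoidAlgebra k G} :
      AugPow k P M j u → AugPow k P M j v → AugPow k P M j (u + v)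
  | smul {j : ℕ} (r : k) {u : MonoidAlgebra k G} : AugPow k P M j u → AugPow k P M j (r • u)
  | one : AugPow k P M 0 1
  | mul {i j : ℕ} {g : G} {u : MonoidAlgebra k G} : g ∈ M → g ∈ P i → AugPow k P M j u →
      AugPow k P M (i + j) ((MonoidAlgebra.of k G g - 1) * u)
  | mono {i j : ℕ} {u : MonoidAlgebra k G} : i ≤ j → AugPow k P M j u → AugPow k P M i u

/-- `AugPow` as a submodule. -/
def augPow (k : Type*) {G : Type*} [Field k] [Group G] (P : ℕ → Subgroup G)
    (M : Subgroup G) (j : ℕ) : Submodule k (MonoidAlgebra k G) where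
  carrier := {u | AugPow k P M j u}
  zero_mem' := .zero j
  add_mem' := .add
  smul_mem' r _ := .smul r

section AugPow

open MonoidAlgebra

variable {k G : Type*} [Field k] [Group G] {c : ℕ} {S : NSeries G c} {M N : Subgroup G}

lemma augPow_antitone : Antitone (augPow k S.P M) := fun _ _ h _ hu => AugPow.mono h hu

lemma augPow_mul_mem {i j : ℕ} {u v : MonoidAlgebra k G} (hu : u ∈ augPow k S.P M i)
    (hv : v ∈ augPow k S.P M j) : u * v ∈ augPow k S.P M (i + j) := by
  change AugPow k S.P M i u at hu
  induction hu with
  | zero => simp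
  | add _ _ h1 h2 => rw [add_mul]; exact add_mem h1 h2
  | smul r _ h => rw [smul_mul_assoc]; exact Submodule.smul_mem _ r h
  | one => simpa using hv
  | mul hg hgi _ h => rw [mul_assoc, add_assoc]; exact AugPow.mul hg hgi h
  | mono hij _ h => exact augPow_antitone (by omega) h

lemma of_sub_one_mem {i : ℕ} {g : G} (hg : g ∈ M) (hgi : g ∈ S.P i) :
    of k G g - 1 ∈ augPow k S.P M i := by
  have h := AugPow.mul (k := k) hg hgi .one
  rwa [mul_one, add_zero] at h

lemma one_mem_augPow : (1 : MonoidAlgebra k G) ∈ augPow k S.P M 0 := AugPow.one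

lemma of_mem_augPow {g : G} (hg : g ∈ M) : of k G g ∈ augPow k S.P M 0 := by
  simpa using add_mem (of_sub_one_mem (k := k) hg (S.mem_zero g)) one_mem_augPow

lemma augPow_mono (h : M ≤ N) (j : ℕ) : augPow k S.P M j ≤ augPow k S.P N j := by
  intro u hu
  change AugPow k S.P M j u at hu
  induction hu with
  | zero => simp
  | add _ _ h1 h2 => exact add_mem h1 h2
  | smul r _ h => exact Submodule.smul_mem _ r h
  | one => exact .one
  | mul hg hgi _ ih => exact AugPow.mul (h hg) hgi ih
  | mono hij _ h => exact augPow_antitone (by omega) h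

lemma augPow_top_zero : augPow k S.P ⊤ 0 = ⊤ := by
  rw [eq_top_iff]
  rintro u -
  induction u using MonoidAlgebra.induction_on with
  | of g => exact of_mem_augPow (Subgroup.mem_top g)
  | add u v hu hv => exact add_mem hu hv
  | smul r u hu => exact Submodule.smul_mem _ r hu

lemma augPow_le_span (j : ℕ) : augPow k S.P M j ≤ Submodule.span k (of k G '' M) := by
  intro u hu
  change AugPow k S.P M j u at hu
  induction hu with
  | zero => simp
  | add _ _ h1 h2 => exact add_mem h1 h2
  | smul r _ h => exact Submodule.smul_mem _ r h
  | one => exact Submodule.subset_span ⟨1, M.one_mem, map_one _⟩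
  | @mul i j g u hg hgi _ ih =>
    rw [sub_mul, one_mul]
    refine sub_mem ?_ ih
    have hle : Submodule.span k (of k G '' M) ≤
        (Submodule.span k (of k G '' M)).comap (LinearMap.mulLeft k (of k G g)) := by
      rw [Submodule.span_le]
      rintro _ ⟨m, hm, rfl⟩
      exact Submodule.subset_span ⟨g * m, M.mul_mem hg hm, map_mul _ _ _⟩
    exact hle ih
  | mono hij _ h => exact h

/-- A linear map which is semilinear with respect to a map raising weights by `d`, raises the
filtration by `d`. -/
lemma map_sub_self_mem {d : ℕ} (Θ : MonoidAlgebra k G →ₗ[k] MonoidAlgebra k G) (φ : G → G)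
    (hΘ : ∀ g ∈ M, ∀ u, Θ (of k G g * u) = of k G (φ g) * Θ u)
    (hφM : ∀ g ∈ M, φ g ∈ M) (hφ : ∀ i, ∀ g ∈ M, g ∈ S.P i → φ g * g⁻¹ ∈ S.P (i + d))
    (h1 : Θ 1 - 1 ∈ augPow k S.P M d) {j : ℕ} {u : MonoidAlgebra k G}
    (hu : u ∈ augPow k S.P M j) : Θ u - u ∈ augPow k S.P M (j + d) := by
  change AugPow k S.P M j u at hu
  induction hu with
  | zero => simp
  | @add j u v _ _ h1 h2 =>
    rw [map_add, add_sub_add_comm]; exact add_mem h1 h2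
  | smul r _ h => rw [map_smul, ← smul_sub]; exact Submodule.smul_mem _ r h
  | one => simpa using h1
  | @mul i j g u hg hgi hu ih =>
    have hΘu : Θ u ∈ augPow k S.P M j := by
      simpa using add_mem (augPow_antitone (Nat.le_add_right j d) ih) hu
    have e : Θ ((of k G g - 1) * u) - (of k G g - 1) * u = (of k G g - 1) * (Θ u - u) +
        (of k G (φ g * g⁻¹) - 1) * (of k G g * Θ u) := by
      have : of k G (φ g) = of k G (φ g * g⁻¹) * of k G g := by rw [← map_mul]; simp
      rw [sub_mul, map_sub, hΘ g hg, one_mul, this]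
      noncomm_ring
    rw [e]
    refine add_mem ?_ ?_
    · rw [add_assoc]; exact AugPow.mul hg hgi ih
    · rw [add_right_comm]
      refine AugPow.mul (M.mul_mem (hφM g hg) (M.inv_mem hg)) (hφ i g hg hgi) ?_
      have h := augPow_mul_mem (of_mem_augPow (k := k) hg) hΘu
      rwa [zero_add] at h
  | mono hij _ h => exact augPow_antitone (by omega) h

end AugPow

section StepSpan

open MonoidAlgebra

/-- The span of the products `v * (x - 1) ^ e` with `v` in the filtration attached to `M`, and
`x` of weight `w`. -/
noncomputable def stepSpan (k : Type*) {G : Type*} [Field k] [Group G]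
    (P : ℕ → Subgroup G) (M : Subgroup G)
    (x : G) (w j : ℕ) : Submodule k (MonoidAlgebra k G) :=
  Submodule.span k
    {u | ∃ i e v, v ∈ augPow k P M i ∧ j ≤ i + e * w ∧ u = v * (of k G x - 1) ^ e}

variable {k G : Type*} [Field k] [Group G] {c : ℕ} {S : NSeries G c} {M N : Subgroup G}
  {x : G} {w : ℕ}

lemma mul_mem_stepSpan {i j e : ℕ} {v : MonoidAlgebra k G} (hv : v ∈ augPow k S.P M i)
    (h : j ≤ i + e * w) : v * (of k G x - 1) ^ e ∈ stepSpan k S.P M x w j :=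
  Submodule.subset_span ⟨i, e, v, hv, h, rfl⟩

lemma stepSpan_antitone : Antitone (stepSpan k S.P M x w) := by
  intro j j' h
  refine Submodule.span_mono ?_
  rintro _ ⟨i, e, v, hv, hj, rfl⟩
  exact ⟨i, e, v, hv, h.trans hj, rfl⟩

lemma mul_stepSpan_of_forall {y : MonoidAlgebra k G} {d j : ℕ}
    (h : ∀ i e v, v ∈ augPow k S.P M i → j ≤ i + e * w →
      y * (v * (of k G x - 1) ^ e) ∈ stepSpan k S.P M x w (d + j))
    {u : MonoidAlgebra k G} (hu : u ∈ stepSpan k S.P M x w j) :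
    y * u ∈ stepSpan k S.P M x w (d + j) := by
  have hle : stepSpan k S.P M x w j ≤
      (stepSpan k S.P M x w (d + j)).comap (LinearMap.mulLeft k y) := by
    refine Submodule.span_le.mpr ?_
    rintro _ ⟨i, e, v, hv, hj, rfl⟩
    exact h i e v hv hj
  exact hle hu

lemma augPow_mul_stepSpan {d j : ℕ} {y : MonoidAlgebra k G} (hy : y ∈ augPow k S.P M d)
    {u : MonoidAlgebra k G} (hu : u ∈ stepSpan k S.P M x w j) :
    y * u ∈ stepSpan k S.P M x w (d + j) := by
  refine mul_stepSpan_of_forall (fun i e v hv hj => ?_) hu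
  rw [← mul_assoc]
  exact mul_mem_stepSpan (augPow_mul_mem hy hv) (by omega)

lemma of_sub_one_mul_stepSpan (hx : x ∈ S.P w) (hM : S.P (w + 1) ≤ M) {j : ℕ}
    {u : MonoidAlgebra k G} (hu : u ∈ stepSpan k S.P M x w j) :
    (of k G x - 1) * u ∈ stepSpan k S.P M x w (w + j) := by
  refine mul_stepSpan_of_forall (fun i e v hv hj => ?_) hu
  let Θ : MonoidAlgebra k G →ₗ[k] MonoidAlgebra k G :=
    (LinearMap.mulLeft k (of k G x)).comp (LinearMap.mulRight k (of k G x⁻¹))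
  have hΘ1 : Θ 1 = 1 := by
    change of k G x * (1 * of k G x⁻¹) = 1
    rw [one_mul, ← map_mul, mul_inv_cancel, map_one]
  have hΘx : Θ v * of k G x = of k G x * v := by
    change of k G x * (v * of k G x⁻¹) * of k G x = _
    rw [mul_assoc, mul_assoc, ← map_mul, inv_mul_cancel, map_one, mul_one]
  have hd : Θ v - v ∈ augPow k S.P M (i + w) := by
    refine map_sub_self_mem Θ (fun g => x * g * x⁻¹) (fun g _ u => ?_)
      (fun g hg => NSeries.conj_mem hx hM hg) (fun l g _ hl => ?_) (by simp [hΘ1]) hv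
    · change of k G x * (of k G g * u * of k G x⁻¹) =
        of k G (x * g * x⁻¹) * (of k G x * (u * of k G x⁻¹))
      rw [← mul_assoc (of k G (x * g * x⁻¹)), ← map_mul, inv_mul_cancel_right, map_mul]
      noncomm_ring
    · rw [add_comm]; exact S.commutator_mem hx hl
  have hΘv : Θ v ∈ augPow k S.P M i := by
    simpa using add_mem (augPow_antitone (Nat.le_add_right i w) hd) hv
  have e1 : (of k G x - 1) * (v * (of k G x - 1) ^ e) =
      Θ v * (of k G x - 1) ^ (e + 1) + (Θ v - v) * (of k G x - 1) ^ e := by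
    rw [pow_succ' _ e, ← mul_assoc, ← mul_assoc, ← add_mul, mul_sub, hΘx]
    noncomm_ring
  rw [e1]
  refine add_mem (mul_mem_stepSpan hΘv ?_) (mul_mem_stepSpan hd ?_)
  · rw [add_mul]; omega
  · omega

lemma of_pow_sub_one_mul_stepSpan (hx : x ∈ S.P w) (hM : S.P (w + 1) ≤ M) (n : ℕ) {j : ℕ}
    {u : MonoidAlgebra k G} (hu : u ∈ stepSpan k S.P M x w j) :
    (of k G (x ^ n) - 1) * u ∈ stepSpan k S.P M x w (w + j) := by
  induction n with
  | zero => simp [MonoidAlgebra.one_def]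
  | succ n ih =>
    have e : (of k G (x ^ (n + 1)) - 1) * u =
        ((of k G x - 1) * ((of k G (x ^ n) - 1) * u) + (of k G (x ^ n) - 1) * u) +
          (of k G x - 1) * u := by
      rw [pow_succ', map_mul]
      noncomm_ring
    rw [e]
    refine add_mem (add_mem ?_ ih) (of_sub_one_mul_stepSpan hx hM hu)
    exact stepSpan_antitone (by omega) (of_sub_one_mul_stepSpan hx hM ih)

/-- If `N` is generated by `M` and the element `x` of weight `w`, then the filtration of `N` is
controlled by the one of `M`. -/
lemma augPow_le_stepSpan (hx : x ∈ S.P w) (hM : S.P (w + 1) ≤ M)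
    (hN : ∀ g ∈ N, ∃ m ∈ M, ∃ n : ℕ, g = m * x ^ n) (j : ℕ) :
    augPow k S.P N j ≤ stepSpan k S.P M x w j := by
  intro u hu
  change AugPow k S.P N j u at hu
  induction hu with
  | zero => simp
  | add _ _ h1 h2 => exact add_mem h1 h2
  | smul r _ h => exact Submodule.smul_mem _ r h
  | one =>
    have h := mul_mem_stepSpan (x := x) (w := w) (e := 0) (j := 0)
      (one_mem_augPow (k := k) (S := S) (M := M)) (Nat.zero_le _)
    simpa using h
  | mono hij _ h => exact stepSpan_antitone hij h
  | @mul i j g u hg hgi _ ih =>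
    by_cases hi : i ≤ w
    · obtain ⟨m, hm, n, rfl⟩ := hN g hg
      have hxn : x ^ n ∈ S.P i := Subgroup.pow_mem _ (S.antitone hi hx) n
      have hmi : m ∈ S.P i := by simpa using (S.P i).mul_mem hgi ((S.P i).inv_mem hxn)
      have e : (of k G (m * x ^ n) - 1) * u =
          of k G m * ((of k G (x ^ n) - 1) * u) + (of k G m - 1) * u := by
        rw [map_mul]
        noncomm_ring
      rw [e]
      refine add_mem ?_ (augPow_mul_stepSpan (of_sub_one_mem hm hmi) ih)
      have h := augPow_mul_stepSpan (of_mem_augPow (S := S) hm)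
        (of_pow_sub_one_mul_stepSpan hx hM n ih)
      exact stepSpan_antitone (by omega) h
    · exact augPow_mul_stepSpan
        (of_sub_one_mem (hM (S.antitone (by omega : w + 1 ≤ i) hgi)) hgi) ih

lemma sub_one_pow_mem_span (y : MonoidAlgebra k G) (e : ℕ) :
    (y - 1) ^ e ∈ Submodule.span k ((fun t => y ^ t) '' Set.Iic e) := by
  induction e with
  | zero => exact Submodule.subset_span ⟨0, by simp⟩
  | succ e ih =>
    rw [pow_succ, mul_sub, mul_one]
    refine sub_mem ?_ (Submodule.span_mono (Set.image_mono (Set.Iic_subset_Iic.mpr e.le_succ)) ih)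
    have hle : Submodule.span k ((fun t => y ^ t) '' Set.Iic e) ≤
        (Submodule.span k ((fun t => y ^ t) '' Set.Iic (e + 1))).comap
          (LinearMap.mulRight k y) := by
      rw [Submodule.span_le]
      rintro _ ⟨t, ht, rfl⟩
      exact Submodule.subset_span ⟨t + 1, Nat.succ_le_succ ht, pow_succ _ _⟩
    exact hle ih

end StepSpan

lemma sub_pow_prime_of_commute {p : ℕ} [Fact p.Prime] {R : Type*} [Ring R] [Algebra (ZMod p) R]
    {a b : R} (h : Commute a b) : (a - b) ^ p = a ^ p - b ^ p := by
  cases subsingleton_or_nontrivial R with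
  | inl _ => exact Subsingleton.elim _ _
  | inr _ =>
    have := charP_of_injective_algebraMap' (ZMod p) (A := R) p
    exact sub_pow_char_of_commute _ h

section ExtendOperator

open MonoidAlgebra

lemma mapDomainLinearMap_of {k G : Type*} [Field k] [Group G] (ξ : G → G) (g : G) :
    mapDomainLinearMap k k ξ (of k G g) = of k G (ξ g) := mapDomain_single

variable {p : ℕ} [Fact p.Prime] {G : Type*} [Group G] {c : ℕ} {S : NSeries G c}

/-- The translates `x ^ e` chosen so that `g * x ^ (-e)` lies in `M`. -/
lemma exists_exponent {M : Subgroup G} {x : G} (hx : x ∉ M) (hxp : x ^ p = 1) :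
    ∃ e : G → ℕ, (∀ m ∈ M, ∀ g, e (m * g) = e g) ∧ ∀ m ∈ M, ∀ t < p, e (m * x ^ t) = t := by
  classical
  let Q : G → ℕ → Prop := fun g n => g * (x ^ n)⁻¹ ∈ M
  have hQ : ∀ m ∈ M, ∀ g, Q (m * g) = Q g := by
    intro m hm g
    funext n
    simp only [Q, mul_assoc, M.mul_mem_cancel_left hm]
  refine ⟨fun g => sInf {n | Q g n}, fun m hm g => by simp only [hQ m hm], ?_⟩
  intro m hm t ht
  have hmem : t ∈ {n | Q (m * x ^ t) n} := by simpa [Q] using hm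
  apply le_antisymm (Nat.sInf_le hmem)
  by_contra! hlt
  have h1 : Q (m * x ^ t) (sInf {n | Q (m * x ^ t) n}) := Nat.sInf_mem ⟨t, hmem⟩
  set s := sInf {n | Q (m * x ^ t) n}
  have h2 : x ^ (t - s) ∈ M := by
    rw [hQ m hm] at h1
    rwa [pow_sub _ hlt.le]
  have := Nat.le_of_dvd (by omega) (dvd_of_pow_mem_of_notMem (Fact.out : p.Prime) hx hxp h2)
  omega

/-- Extending an operator raising the filtration of `M` to a subgroup generated by `M` and one more
element. -/
lemma exists_extend_operator {A M N : Subgroup G} {x : G} {w d : ℕ} (hAM : A ≤ M) (hMN : M ≤ N)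
    (hxN : x ∈ N) (hxM : x ∉ M) (hxp : x ^ p = 1) (hx : x ∈ S.P w) (hM : S.P (w + 1) ≤ M)
    (hN : ∀ g ∈ N, ∃ m ∈ M, ∃ n : ℕ, g = m * x ^ n) (φ ξ : G → G)
    (hξ : ∀ a ∈ A, ∀ g, ξ (a * g) = φ a * ξ g)
    (hξd : ∀ j, ∀ u ∈ augPow (ZMod p) S.P M j,
      mapDomainLinearMap (ZMod p) (ZMod p) ξ u - u ∈ augPow (ZMod p) S.P M (j + d)) :
    ∃ ξ' : G → G, (∀ a ∈ A, ∀ g, ξ' (a * g) = φ a * ξ' g) ∧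
      ∀ j, ∀ u ∈ augPow (ZMod p) S.P N j,
        mapDomainLinearMap (ZMod p) (ZMod p) ξ' u - u ∈ augPow (ZMod p) S.P N (j + d) := by
  obtain ⟨e, heM, het⟩ := exists_exponent hxM hxp
  let ξ' : G → G := fun g => ξ (g * (x ^ e g)⁻¹) * x ^ e g
  let X := mapDomainLinearMap (ZMod p) (ZMod p) ξ
  let X' := mapDomainLinearMap (ZMod p) (ZMod p) ξ'
  have hX' : ∀ v ∈ Submodule.span (ZMod p) (of (ZMod p) G '' M), ∀ t < p,
      X' (v * of (ZMod p) G x ^ t) = X v * of (ZMod p) G x ^ t := by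
    intro v hv t ht
    refine LinearMap.eqOn_span (f := X' ∘ₗ LinearMap.mulRight _ (of (ZMod p) G x ^ t))
      (g := LinearMap.mulRight _ (of (ZMod p) G x ^ t) ∘ₗ X) ?_ hv
    rintro _ ⟨m, hm, rfl⟩
    change X' (of (ZMod p) G m * of (ZMod p) G x ^ t) = X (of (ZMod p) G m) * of (ZMod p) G x ^ t
    rw [← map_pow, ← map_mul, mapDomainLinearMap_of, mapDomainLinearMap_of, ← map_mul]
    simp only [ξ', het m hm t ht, mul_inv_cancel_right]
  have hX'e : ∀ v ∈ Submodule.span (ZMod p) (of (ZMod p) G '' M), ∀ s < p,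
      X' (v * (of (ZMod p) G x - 1) ^ s) = X v * (of (ZMod p) G x - 1) ^ s := by
    intro v hv s hs
    refine LinearMap.eqOn_span (f := X' ∘ₗ LinearMap.mulLeft _ v)
      (g := LinearMap.mulLeft _ (X v)) ?_ (sub_one_pow_mem_span _ s)
    rintro _ ⟨t, ht, rfl⟩
    exact hX' v hv t (lt_of_le_of_lt ht hs)
  refine ⟨ξ', fun a ha g => ?_, fun j u hu => ?_⟩
  · simp only [ξ', heM a (hAM ha), mul_assoc, hξ a ha]
  · have hle : stepSpan (ZMod p) S.P M x w j ≤
        (augPow (ZMod p) S.P N (j + d)).comap (X' - LinearMap.id) := by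
      refine Submodule.span_le.mpr ?_
      rintro _ ⟨i, s, v, hv, hj, rfl⟩
      change X' (v * _) - v * _ ∈ augPow (ZMod p) S.P N (j + d)
      by_cases hs : s < p
      · rw [hX'e v (augPow_le_span i hv) s hs, ← sub_mul]
        have h1 := augPow_mono hMN _ (hξd i v hv)
        have h2 : (of (ZMod p) G x - 1) ^ s ∈ augPow (ZMod p) S.P N (s * w) := by
          clear hj hs
          induction s with
          | zero => simpa using one_mem_augPow
          | succ s ih =>
            rw [pow_succ, Nat.succ_mul]
            exact augPow_mul_mem ih (of_sub_one_mem hxN hx)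
        exact augPow_antitone (by omega) (augPow_mul_mem h1 h2)
      · have h0 : (of (ZMod p) G x - 1) ^ s = 0 := by
          obtain ⟨r, rfl⟩ := Nat.exists_eq_add_of_le (not_lt.mp hs)
          rw [pow_add, sub_pow_prime_of_commute (Commute.one_right _), ← map_pow, hxp, map_one,
            one_pow, sub_self, zero_mul]
        rw [h0, mul_zero, map_zero, sub_zero]
        exact zero_mem _
    exact hle (augPow_le_stepSpan hx hM hN j hu)

/-- A weight-raising endomorphism of a subgroup `A` is induced by an operator of the group algebra
raising the filtration. -/
lemma exists_operator [Finite G] (hexp : ∀ g : G, g ^ p = 1) (A : Subgroup G) (φ : G → G) {d : ℕ}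
    (hφmul : ∀ a ∈ A, ∀ b ∈ A, φ (a * b) = φ a * φ b) (hφA : ∀ a ∈ A, φ a ∈ A)
    (hφ : ∀ i, ∀ a ∈ A, a ∈ S.P i → φ a * a⁻¹ ∈ S.P (i + d)) :
    ∃ ξ : G → G, (∀ a ∈ A, ∀ g, ξ (a * g) = φ a * ξ g) ∧
      ∀ j, ∀ u ∈ augPow (ZMod p) S.P ⊤ j,
        mapDomainLinearMap (ZMod p) (ZMod p) ξ u - u ∈ augPow (ZMod p) S.P ⊤ (j + d) := by
  let C : Subgroup G → Prop := fun M => A ≤ M ∧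
    ∃ ξ : G → G, (∀ a ∈ A, ∀ g, ξ (a * g) = φ a * ξ g) ∧
      ∀ j, ∀ u ∈ augPow (ZMod p) S.P M j,
        mapDomainLinearMap (ZMod p) (ZMod p) ξ u - u ∈ augPow (ZMod p) S.P M (j + d)
  have hA : C A := by
    let r : G → G := fun g => (Quotient.mk (QuotientGroup.rightRel A) g).out
    have hr : ∀ a ∈ A, ∀ g, r (a * g) = r g := by
      intro a ha g
      have : Quotient.mk (QuotientGroup.rightRel A) (a * g) =
          Quotient.mk (QuotientGroup.rightRel A) g := by
        refine Quotient.sound ?_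
        change QuotientGroup.rightRel A (a * g) g
        rw [QuotientGroup.rightRel_apply]
        simpa using ha
      simp only [r, this]
    have hrA : ∀ g, g * (r g)⁻¹ ∈ A := by
      intro g
      have : QuotientGroup.rightRel A (r g) g := Quotient.mk_out (s := QuotientGroup.rightRel A) g
      rwa [QuotientGroup.rightRel_apply] at this
    have hξ : ∀ a ∈ A, ∀ g, φ (a * g * (r (a * g))⁻¹) * r (a * g) =
        φ a * (φ (g * (r g)⁻¹) * r g) := by
      intro a ha g
      rw [hr a ha, mul_assoc a, hφmul a ha _ (hrA g), mul_assoc]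
    refine ⟨le_rfl, fun g => φ (g * (r g)⁻¹) * r g, hξ, fun j u hu => ?_⟩
    refine map_sub_self_mem _ φ (fun a ha u => ?_) hφA hφ ?_ hu
    · induction u using MonoidAlgebra.induction_on with
      | of g =>
        rw [← map_mul, mapDomainLinearMap_of, mapDomainLinearMap_of, ← map_mul, hξ a ha]
      | add u v hu hv => simp only [mul_add, map_add, hu, hv]
      | smul s u hu => simp only [mul_smul_comm, map_smul, hu]
    · have h1 := hrA 1
      rw [one_mul] at h1
      have h2 := of_sub_one_mem (k := ZMod p) (A.mul_mem (hφA _ h1) (A.inv_mem h1))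
        (hφ 0 _ h1 (S.mem_zero _))
      simpa [MonoidAlgebra.one_def] using h2
  obtain ⟨M, hM⟩ := (Set.toFinite {M | C M}).exists_maximal ⟨A, hA⟩
  obtain ⟨hAM, ξ, hξ, hξd⟩ := hM.prop
  by_cases htop : M = ⊤
  · subst htop
    exact ⟨ξ, hξ, hξd⟩
  · obtain ⟨w, x, -, -, hx, hxM, hw⟩ := S.exists_maximal_weight htop
    have hxN : x ∈ M ⊔ Subgroup.zpowers x :=
      (le_sup_right : _ ≤ M ⊔ _) (Subgroup.mem_zpowers x)
    have hN : C (M ⊔ Subgroup.zpowers x) := ⟨hAM.trans le_sup_left,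
      exists_extend_operator hAM le_sup_left hxN hxM (hexp x) hx hw
        (fun g hg => NSeries.exists_eq_mul_pow (Fact.out : p.Prime).ne_zero (hexp x) hx hw hg)
        φ ξ hξ hξd⟩
    exact absurd (hM.le_of_ge hN le_sup_left hxN) hxM

end ExtendOperator

/-- A filtration `⊤ = Fil 0 ≥ Fil 1 ≥ ⋯ ≥ Fil (c + 1) = ⊥` of a module. -/
structure ModuleFiltration (k E : Type*) [Field k] [AddCommGroup E] [Module k E] (c : ℕ) where
  Fil : ℕ → Submodule k E
  antitone : Antitone Fil
  zero_eq_top : Fil 0 = ⊤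
  succ_eq_bot : Fil (c + 1) = ⊥

namespace ModuleFiltration

section Shift

variable {k E : Type*} [Field k] [AddCommGroup E] [Module k E] {c : ℕ}
  (V : ModuleFiltration k E c)

/-- The endomorphisms raising the filtration by at least `i`. -/
def shift (i : ℕ) : Submodule k (Module.End k E) where
  carrier := {T | ∀ j, ∀ v ∈ V.Fil j, T v ∈ V.Fil (i + j)}
  zero_mem' := fun j v _ => by simp
  add_mem' := fun hS hT j v hv => add_mem (hS j v hv) (hT j v hv)
  smul_mem' := fun r _ hT j v hv => Submodule.smul_mem _ r (hT j v hv)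

lemma shift_antitone : Antitone V.shift := fun _ _ h _ hT j v hv =>
  V.antitone (Nat.add_le_add_right h j) (hT j v hv)

lemma one_mem_shift : 1 ∈ V.shift 0 := fun j v hv => by simpa using hv

variable {V}

lemma mul_mem_shift {i j : ℕ} {S T : Module.End k E} (hS : S ∈ V.shift i) (hT : T ∈ V.shift j) :
    S * T ∈ V.shift (i + j) := fun l v hv => by
  rw [add_assoc]; exact hS _ _ (hT _ _ hv)

lemma eq_zero_of_mem_shift {i : ℕ} (hi : c + 1 ≤ i) {T : Module.End k E} (hT : T ∈ V.shift i) :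
    T = 0 := by
  ext v
  have h := V.antitone hi (by simpa using hT 0 v (by simp [V.zero_eq_top]))
  rw [V.succ_eq_bot] at h
  simpa using h

lemma mem_shift_zero {i : ℕ} {T : Module.End k E} (hT : T - 1 ∈ V.shift i) : T ∈ V.shift 0 := by
  simpa using add_mem (V.shift_antitone (Nat.zero_le i) hT) V.one_mem_shift

lemma mul_sub_one_mem_shift {i : ℕ} {S T : Module.End k E} (hS : S - 1 ∈ V.shift i)
    (hT : T - 1 ∈ V.shift i) : S * T - 1 ∈ V.shift i := by
  have h := mul_mem_shift hS (mem_shift_zero hT)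
  have e : S * T - 1 = (S - 1) * T + (T - 1) := by noncomm_ring
  rw [e]
  exact add_mem (by simpa using h) hT

lemma pow_sub_one_mem_shift {i : ℕ} {T : Module.End k E} (hT : T - 1 ∈ V.shift i) (n : ℕ) :
    T ^ n - 1 ∈ V.shift i := by
  induction n with
  | zero => simp
  | succ n ih => rw [pow_succ]; exact mul_sub_one_mem_shift ih hT

lemma pow_mem_shift {T : Module.End k E} (hT : T ∈ V.shift 1) (n : ℕ) : T ^ n ∈ V.shift n := by
  induction n with
  | zero => simpa using V.one_mem_shift
  | succ n ih => rw [pow_succ]; exact mul_mem_shift ih hT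

end Shift

section Units

variable {p : ℕ} [Fact p.Prime] {E : Type*} [AddCommGroup E] [Module (ZMod p) E] {c : ℕ}

lemma pow_prime_eq_one {V : ModuleFiltration (ZMod p) E c} (hcp : c < p)
    {T : Module.End (ZMod p) E} (hT : T - 1 ∈ V.shift 1) : T ^ p = 1 := by
  have h := sub_pow_prime_of_commute (p := p) (Commute.one_right T)
  rw [eq_zero_of_mem_shift hcp (pow_mem_shift hT p), one_pow] at h
  exact (sub_eq_zero.mp h.symm)

variable (V : ModuleFiltration (ZMod p) E c) (hcp : c < p)

/-- The automorphisms which are congruent to the identity up to degree `max i 1`. -/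
def level (hcp : c < p) (i : ℕ) : Subgroup (Module.End (ZMod p) E)ˣ where
  carrier := {u | (u : Module.End (ZMod p) E) - 1 ∈ V.shift (max i 1)}
  one_mem' := by simp
  mul_mem' := fun ha hb => by
    simp only [Set.mem_ofPred_eq, Units.val_mul] at *
    exact mul_sub_one_mem_shift ha hb
  inv_mem' := fun {u} hu => by
    simp only [Set.mem_ofPred_eq] at *
    have hup : u ^ p = 1 := Units.ext (by
      simpa using pow_prime_eq_one hcp (V.shift_antitone (le_max_right i 1) hu))
    have e : u⁻¹ = u ^ (p - 1) := by
      rw [inv_eq_iff_mul_eq_one, ← pow_succ', Nat.sub_add_cancel (Fact.out : p.Prime).one_le, hup]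
    rw [e, Units.val_pow_eq_pow_val]
    exact pow_sub_one_mem_shift hu _

/-- The group of automorphisms inducing the identity on the graded module. -/
abbrev UnipotentGroup : Type _ := V.level hcp 1

variable {V hcp}

lemma sub_one_mem (u : V.UnipotentGroup hcp) :
    ((u : (Module.End (ZMod p) E)ˣ) : Module.End (ZMod p) E) - 1 ∈ V.shift 1 := u.2

lemma unipotent_pow_prime (u : V.UnipotentGroup hcp) : u ^ p = 1 := by
  refine Subtype.ext (Units.ext ?_)
  simpa using pow_prime_eq_one hcp (sub_one_mem u)

variable (V hcp)

/-- The congruence subgroups form an `NSeries`. -/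
def unipotentSeries : NSeries (V.UnipotentGroup hcp) c where
  P i := (V.level hcp i).subgroupOf (V.level hcp 1)
  antitone i j h u hu := V.shift_antitone (max_le_max_right 1 h) hu
  one_eq_top := by simp
  succ_eq_bot := by
    rw [eq_bot_iff]
    intro u hu
    refine Subtype.ext (Units.ext ?_)
    exact sub_eq_zero.mp (eq_zero_of_mem_shift (le_max_left _ _) hu)
  commutator_mem := by
    intro i j x y hx hy
    obtain ⟨x, hx1⟩ := x
    obtain ⟨y, hy1⟩ := y
    change (x : Module.End (ZMod p) E) - 1 ∈ V.shift (max i 1) at hx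
    change (y : Module.End (ZMod p) E) - 1 ∈ V.shift (max j 1) at hy
    change ((x * y * x⁻¹ * y⁻¹ : (Module.End (ZMod p) E)ˣ) : Module.End (ZMod p) E) - 1 ∈
      V.shift (max (i + j) 1)
    have e : ((x * y * x⁻¹ * y⁻¹ : (Module.End (ZMod p) E)ˣ) : Module.End (ZMod p) E) - 1 =
        ((x.1 - 1) * (y.1 - 1) - (y.1 - 1) * (x.1 - 1)) * (x⁻¹ * y⁻¹ : (Module.End (ZMod p) E)ˣ) := by
      have h1 : (y.1 * x.1) * ((x⁻¹ * y⁻¹ : (Module.End (ZMod p) E)ˣ) : Module.End (ZMod p) E)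
          = 1 := by
        rw [← Units.val_mul, ← Units.val_mul]; simp
      have h2 : (x.1 - 1) * (y.1 - 1) - (y.1 - 1) * (x.1 - 1) = x.1 * y.1 - y.1 * x.1 := by
        noncomm_ring
      rw [h2, sub_mul, h1]
      simp [mul_assoc]
    have hinv : ((x⁻¹ * y⁻¹ : (Module.End (ZMod p) E)ˣ) : Module.End (ZMod p) E) ∈ V.shift 0 :=
      mem_shift_zero (i := max 1 1)
        ((V.level hcp 1).mul_mem ((V.level hcp 1).inv_mem hx1) ((V.level hcp 1).inv_mem hy1))
    have hle : max (i + j) 1 ≤ max i 1 + max j 1 := by omega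
    rw [e]
    refine mul_mem_shift (i := max (i + j) 1) (j := 0) (sub_mem ?_ ?_) hinv
    · exact V.shift_antitone hle (mul_mem_shift hx hy)
    · exact V.shift_antitone (hle.trans (add_comm _ _).le) (mul_mem_shift hy hx)

variable {V hcp}

lemma mem_unipotentSeries {i : ℕ} (hi : 1 ≤ i) {u : V.UnipotentGroup hcp} :
    u ∈ (V.unipotentSeries hcp).P i ↔
      ((u : (Module.End (ZMod p) E)ˣ) : Module.End (ZMod p) E) - 1 ∈ V.shift i := by
  change ((u : (Module.End (ZMod p) E)ˣ) : Module.End (ZMod p) E) - 1 ∈ V.shift (max i 1) ↔ _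
  rw [max_eq_left hi]

end Units

end ModuleFiltration

/-- The series `S` is recovered from the filtration it induces on the group algebra. -/
def NSeries.Detects {G : Type*} [Group G] {c : ℕ} (S : NSeries G c) (k : Type*) [Field k] : Prop :=
  ∀ i g, MonoidAlgebra.of k G g - 1 ∈ augPow k S.P ⊤ i → g ∈ S.P i

namespace ModuleFiltration

variable {p : ℕ} [Fact p.Prime] {E : Type*} [AddCommGroup E] [Module (ZMod p) E] {c : ℕ}
  (V : ModuleFiltration (ZMod p) E c) (hcp : c < p)

lemma unipotentSeries_detects : (V.unipotentSeries hcp).Detects (ZMod p) := by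
  intro i g hg
  rcases Nat.eq_zero_or_pos i with rfl | hi
  · exact NSeries.mem_zero _ g
  let ρ : V.UnipotentGroup hcp →* Module.End (ZMod p) E :=
    (Units.coeHom _).comp (V.level hcp 1).subtype
  let Λ := MonoidAlgebra.lift (ZMod p) (Module.End (ZMod p) E) (V.UnipotentGroup hcp) ρ
  have key : ∀ j, ∀ u, AugPow (ZMod p) (V.unipotentSeries hcp).P ⊤ j u → Λ u ∈ V.shift j := by
    intro j u hu
    induction hu with
    | zero => simp
    | add _ _ h1 h2 => rw [map_add]; exact add_mem h1 h2
    | smul r _ h => rw [map_smul]; exact Submodule.smul_mem _ r h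
    | one => rw [map_one]; exact V.one_mem_shift
    | @mul i j g u _ hgi _ ih =>
      rw [map_mul, map_sub, map_one, MonoidAlgebra.lift_of]
      refine mul_mem_shift ?_ ih
      exact V.shift_antitone (le_max_left i 1) hgi
    | mono hij _ h => exact V.shift_antitone hij h
  have h := key i _ hg
  rw [map_sub, map_one, MonoidAlgebra.lift_of] at h
  exact (mem_unipotentSeries hi).mpr h

end ModuleFiltration

namespace ModuleFiltration

section Constructions

variable {k E E' : Type*} [Field k] [AddCommGroup E] [Module k E] [AddCommGroup E'] [Module k E']
  {c : ℕ}

/-- The direct sum of two filtered modules. -/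
def prod (V : ModuleFiltration k E c) (W : ModuleFiltration k E' c) :
    ModuleFiltration k (E × E') c where
  Fil j := (V.Fil j).prod (W.Fil j)
  antitone _ _ h := Submodule.prod_mono (V.antitone h) (W.antitone h)
  zero_eq_top := by rw [V.zero_eq_top, W.zero_eq_top, Submodule.prod_top]
  succ_eq_bot := by rw [V.succ_eq_bot, W.succ_eq_bot, Submodule.prod_bot]

lemma prodMap_sub_one_mem_shift {V : ModuleFiltration k E c} {W : ModuleFiltration k E' c}
    {S : Module.End k E} {T : Module.End k E'} {i : ℕ} :
    LinearMap.prodMap S T - 1 ∈ (V.prod W).shift i ↔ S - 1 ∈ V.shift i ∧ T - 1 ∈ W.shift i := by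
  constructor
  · intro h
    refine ⟨fun j v hv => ?_, fun j w hw => ?_⟩
    · exact (Submodule.mem_prod.mp (h j (v, 0) (Submodule.mem_prod.mpr ⟨hv, zero_mem _⟩))).1
    · exact (Submodule.mem_prod.mp (h j (0, w) (Submodule.mem_prod.mpr ⟨zero_mem _, hw⟩))).2
  · rintro ⟨h1, h2⟩ j v hv
    exact Submodule.mem_prod.mpr ⟨h1 j _ hv.1, h2 j _ hv.2⟩

lemma mem_shift_of_prodMap_mul_pow {V : ModuleFiltration k E c} {W : ModuleFiltration k E' c}
    {S S' : Module.End k E} {T T' : Module.End k E'} {i n : ℕ}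
    (h : LinearMap.prodMap S T * LinearMap.prodMap S' T' ^ n - 1 ∈ (V.prod W).shift i) :
    S * S' ^ n - 1 ∈ V.shift i ∧ T * T' ^ n - 1 ∈ W.shift i := by
  have hpow : LinearMap.prodMap S' T' ^ n = LinearMap.prodMap (S' ^ n) (T' ^ n) :=
    (map_pow (LinearMap.prodMapRingHom k E E') (S', T') n).symm
  rw [hpow, LinearMap.prodMap_mul] at h
  exact prodMap_sub_one_mem_shift.mp h

variable (k c) in
/-- The filtration of `k ^ (c + 1)` by the position of the first nonzero coordinate. -/
def coordinate : ModuleFiltration k (Fin (c + 1) → k) c where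
  Fil j :=
    { carrier := {f | ∀ i : Fin (c + 1), (i : ℕ) < j → f i = 0}
      zero_mem' := fun i _ => rfl
      add_mem' := fun hf hg i hi => by simp [hf i hi, hg i hi]
      smul_mem' := fun r _ hf i hi => by simp [hf i hi] }
  antitone _ _ h _ hf i hi := hf i (hi.trans_le h)
  zero_eq_top := by
    rw [eq_top_iff]; intro f _ i hi; exact absurd hi (Nat.not_lt_zero _)
  succ_eq_bot := by
    rw [eq_bot_iff]; intro f hf; ext i; exact hf i i.2

/-- The operator `w ↦ w + w₀ • e_l`. -/
def transvection (l : Fin (c + 1)) : Module.End k (Fin (c + 1) → k) :=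
  1 + (LinearMap.single k (fun _ => k) l).comp (LinearMap.proj 0)

lemma transvection_pow_apply {l : Fin (c + 1)} (hl : l ≠ 0) (n : ℕ) (w : Fin (c + 1) → k) :
    (transvection l ^ n) w = w + Pi.single l ((n : k) * w 0) := by
  induction n with
  | zero => simp
  | succ n ih =>
    rw [pow_succ', Module.End.mul_apply, ih]
    simp [transvection, Pi.single_eq_of_ne hl.symm, add_mul, Pi.single_add, add_assoc]

lemma transvection_sub_one_mem (l : Fin (c + 1)) :
    transvection l - 1 ∈ (coordinate k c).shift l := by
  intro j w hw i hi
  simp only [transvection, add_sub_cancel_left, LinearMap.comp_apply, LinearMap.proj_apply,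
    LinearMap.single_apply]
  rcases Nat.eq_zero_or_pos j with rfl | hj
  · exact Pi.single_eq_of_ne (by rintro rfl; simp at hi) _
  · rw [hw 0 hj]; simp

lemma transvection_pow_sub_one_mem {l : Fin (c + 1)} (hl : l ≠ 0) {n i : ℕ}
    (h : transvection l ^ n - 1 ∈ (coordinate k c).shift i) (hn : (n : k) ≠ 0) : i ≤ l := by
  by_contra hi
  have h1 := h 0 (Pi.single 0 1) (by simp [(coordinate k c).zero_eq_top]) l (by simpa using hi)
  rw [LinearMap.sub_apply, transvection_pow_apply hl] at h1
  simp at h1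
  exact hn h1

variable (k) in
/-- The truncated group algebra with the filtration induced by an `NSeries`. -/
noncomputable def groupAlgebra {G : Type*} [Group G] (S : NSeries G c) :
    ModuleFiltration k (MonoidAlgebra k G ⧸ augPow k S.P ⊤ (c + 1)) c where
  Fil j := (augPow k S.P ⊤ j).map (Submodule.mkQ _)
  antitone _ _ h := Submodule.map_mono (augPow_antitone h)
  zero_eq_top := by rw [augPow_top_zero, Submodule.map_top, Submodule.range_mkQ]
  succ_eq_bot := by rw [Submodule.mkQ_map_self]

end Constructions

section GroupAlgebra

open MonoidAlgebra

variable {k : Type*} [Field k] {G : Type*} [Group G] {c : ℕ} (S : NSeries G c)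

lemma augPow_le_comap_mulLeft (g : G) :
    augPow k S.P ⊤ (c + 1) ≤ (augPow k S.P ⊤ (c + 1)).comap (LinearMap.mulLeft k (of k G g)) := by
  intro u hu
  have h := augPow_mul_mem (of_mem_augPow (k := k) (S := S) (Subgroup.mem_top g)) hu
  rwa [zero_add] at h

variable (k) in
/-- Left multiplication on the truncated group algebra. -/
noncomputable def leftMul : G →* Module.End k (MonoidAlgebra k G ⧸ augPow k S.P ⊤ (c + 1)) where
  toFun g := Submodule.mapQ _ _ _ (augPow_le_comap_mulLeft (k := k) S g)
  map_one' := by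
    refine Submodule.linearMap_qext _ (LinearMap.ext fun u => ?_)
    simp [← one_def]
  map_mul' g h := by
    refine Submodule.linearMap_qext _ (LinearMap.ext fun u => ?_)
    simp only [LinearMap.comp_apply, Submodule.mkQ_apply, Module.End.mul_apply,
      Submodule.mapQ_apply, LinearMap.mulLeft_apply, map_mul, mul_assoc]

lemma leftMul_mk (g : G) (u : MonoidAlgebra k G) :
    leftMul k S g (Submodule.Quotient.mk u) = Submodule.Quotient.mk (of k G g * u) := rfl

lemma mk_mem_groupAlgebra {j : ℕ} {u : MonoidAlgebra k G} (hu : u ∈ augPow k S.P ⊤ j) :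
    Submodule.Quotient.mk u ∈ (groupAlgebra k S).Fil j := ⟨u, hu, rfl⟩

lemma leftMul_sub_one_mem {i : ℕ} {g : G} (hg : g ∈ S.P i) :
    leftMul k S g - 1 ∈ (groupAlgebra k S).shift i := by
  rintro j _ ⟨u, hu, rfl⟩
  rw [LinearMap.sub_apply, Submodule.mkQ_apply, leftMul_mk, Module.End.one_apply,
    ← Submodule.Quotient.mk_sub, ← sub_one_mul]
  exact mk_mem_groupAlgebra S (augPow_mul_mem (of_sub_one_mem (Subgroup.mem_top g) hg) hu)

variable {S} in
lemma mem_of_leftMul_sub_one_mem (hS : S.Detects k) {i : ℕ} {g : G}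
    (hg : leftMul k S g - 1 ∈ (groupAlgebra k S).shift i) : g ∈ S.P i := by
  have h : ∀ i ≤ c + 1, leftMul k S g - 1 ∈ (groupAlgebra k S).shift i → g ∈ S.P i := by
    intro i hi hg
    obtain ⟨u, hu, he⟩ := hg 0 (Submodule.Quotient.mk 1) (mk_mem_groupAlgebra S one_mem_augPow)
    rw [LinearMap.sub_apply, leftMul_mk, Module.End.one_apply,
      ← Submodule.Quotient.mk_sub, mul_one, Submodule.mkQ_apply, Submodule.Quotient.eq] at he
    refine hS i g ?_
    have := sub_mem (hu : u ∈ augPow k S.P ⊤ i) (augPow_antitone hi he)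
    simpa using this
  rcases le_total i (c + 1) with hi | hi
  · exact h i hi hg
  · rw [S.eq_one_of_mem le_rfl (h (c + 1) le_rfl (shift_antitone _ hi hg))]
    exact one_mem _

lemma exists_groupAlgebra_operator {d : ℕ} (Θ : MonoidAlgebra k G →ₗ[k] MonoidAlgebra k G)
    (hΘ : ∀ j, ∀ u ∈ augPow k S.P ⊤ j, Θ u - u ∈ augPow k S.P ⊤ (j + d)) :
    ∃ T : Module.End k (MonoidAlgebra k G ⧸ augPow k S.P ⊤ (c + 1)),
      (∀ u, T (Submodule.Quotient.mk u) = Submodule.Quotient.mk (Θ u)) ∧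
      T - 1 ∈ (groupAlgebra k S).shift d := by
  have hle : augPow k S.P ⊤ (c + 1) ≤ (augPow k S.P ⊤ (c + 1)).comap Θ := by
    intro u hu
    have := add_mem (augPow_antitone (Nat.le_add_right _ d) (hΘ _ u hu)) hu
    simpa using this
  refine ⟨Submodule.mapQ _ _ Θ hle, fun u => rfl, ?_⟩
  rintro j _ ⟨u, hu, rfl⟩
  rw [LinearMap.sub_apply, Submodule.mkQ_apply, Submodule.mapQ_apply, Module.End.one_apply,
    ← Submodule.Quotient.mk_sub, add_comm d j]
  exact mk_mem_groupAlgebra S (hΘ j u hu)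

end GroupAlgebra

section OfMem

variable {p : ℕ} [Fact p.Prime] {E : Type*} [AddCommGroup E] [Module (ZMod p) E] {c : ℕ}
  (V : ModuleFiltration (ZMod p) E c) (hcp : c < p)

/-- The element of the unipotent group given by an endomorphism congruent to the identity. -/
def unipotentOf (T : Module.End (ZMod p) E) (hT : T - 1 ∈ V.shift 1) : V.UnipotentGroup hcp :=
  ⟨Units.ofPowEqOne T p (pow_prime_eq_one hcp hT) (Fact.out : p.Prime).ne_zero, hT⟩

lemma coe_unipotentOf (T : Module.End (ZMod p) E) (hT : T - 1 ∈ V.shift 1) :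
    ((V.unipotentOf hcp T hT : (Module.End (ZMod p) E)ˣ) : Module.End (ZMod p) E) = T := rfl

end OfMem

end ModuleFiltration

/-- A homomorphism of groups with series is strict if it induces an embedding of filtrations. -/
def NSeries.Strict {G H : Type*} [Group G] [Group H] {c : ℕ} (S : NSeries G c)
    (T : NSeries H c) (f : G →* H) : Prop := ∀ i g, f g ∈ T.P i ↔ g ∈ S.P i

/-- A finite group of exponent `p` with an `NSeries` detected by its group algebra. -/
structure DetectedGroup (p c : ℕ) [Fact p.Prime] where
  carrier : Type
  [group : Group carrier]
  [finite : Finite carrier]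
  pow_eq_one : ∀ g : carrier, g ^ p = 1
  series : NSeries carrier c
  detects : series.Detects (ZMod p)

namespace DetectedGroup

attribute [instance] DetectedGroup.group DetectedGroup.finite

instance (p c : ℕ) [Fact p.Prime] : CoeSort (DetectedGroup p c) Type := ⟨carrier⟩

variable {p c : ℕ} [Fact p.Prime]

/-- The homomorphism `j` solves every problem of realizing a weight-raising partial
automorphism as an inner automorphism. -/
def Realizes (L L' : DetectedGroup p c) (j : L →* L') : Prop :=
  ∀ (A : Subgroup L) (φ : L → L) (d : ℕ), 1 ≤ d → d ≤ c →
    (∀ a ∈ A, ∀ b ∈ A, φ (a * b) = φ a * φ b) → (∀ a ∈ A, φ a ∈ A) →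
    (∀ i, ∀ a ∈ A, a ∈ L.series.P i → φ a * a⁻¹ ∈ L.series.P (i + d)) →
    ∃ x ∈ L'.series.P d, (∀ a ∈ A, x * j a * x⁻¹ = j (φ a)) ∧
      ∀ (g : L) (n i : ℕ), ¬ p ∣ n → j g * x ^ n ∈ L'.series.P i → i ≤ d

open ModuleFiltration in
theorem exists_realizes (hcp : c < p) (L : DetectedGroup p c) :
    ∃ (L' : DetectedGroup p c) (j : L →* L'), L.series.Strict L'.series j ∧ Realizes L L' j := by
  let V := (groupAlgebra (ZMod p) L.series).prod (coordinate (ZMod p) c)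
  have : Finite (MonoidAlgebra (ZMod p) L) := Module.finite_of_finite (ZMod p)
  have : Finite (Module.End (ZMod p) ((MonoidAlgebra (ZMod p) L ⧸
      augPow (ZMod p) L.series.P ⊤ (c + 1)) × (Fin (c + 1) → ZMod p))) :=
    Module.finite_of_finite (ZMod p)
  let L' : DetectedGroup p c :=
    { carrier := V.UnipotentGroup hcp
      pow_eq_one := unipotent_pow_prime
      series := V.unipotentSeries hcp
      detects := V.unipotentSeries_detects hcp }
  have hmem : ∀ {i : ℕ} {g : L}, g ∈ L.series.P i →
      LinearMap.prodMap (leftMul (ZMod p) L.series g) 1 - 1 ∈ V.shift i := fun hg =>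
    prodMap_sub_one_mem_shift.mpr ⟨leftMul_sub_one_mem _ hg, by simp⟩
  let j : L →* L' :=
    { toFun := fun g => V.unipotentOf hcp _ (hmem (L.series.mem_one g))
      map_one' := by
        refine Subtype.ext (Units.ext ?_)
        change LinearMap.prodMap (leftMul (ZMod p) L.series 1) 1 = 1
        rw [map_one]; rfl
      map_mul' := fun g h => by
        refine Subtype.ext (Units.ext ?_)
        change LinearMap.prodMap (leftMul (ZMod p) L.series (g * h)) 1 =
          LinearMap.prodMap (leftMul (ZMod p) L.series g) 1 *
          LinearMap.prodMap (leftMul (ZMod p) L.series h) 1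
        rw [map_mul]; rfl }
  refine ⟨L', j, ?_, ?_⟩
  · intro i g
    rcases Nat.eq_zero_or_pos i with rfl | hi
    · exact iff_of_true (NSeries.mem_zero _ _) (NSeries.mem_zero _ _)
    · refine (mem_unipotentSeries hi).trans ⟨fun h => ?_, hmem⟩
      exact mem_of_leftMul_sub_one_mem L.detects (prodMap_sub_one_mem_shift.mp h).1
  · intro A φ d hd1 hdc hφmul hφA hφ
    obtain ⟨ξ, hξ, hξs⟩ := exists_operator L.pow_eq_one A φ hφmul hφA hφ
    obtain ⟨T, hT, hTs⟩ := exists_groupAlgebra_operator L.series _ hξs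
    let l : Fin (c + 1) := ⟨d, by omega⟩
    have hl : l ≠ 0 := by
      intro h
      have := congrArg Fin.val h
      simp only [l, Fin.val_zero] at this
      omega
    have hX : LinearMap.prodMap T (transvection l) - 1 ∈ V.shift d :=
      prodMap_sub_one_mem_shift.mpr ⟨hTs, transvection_sub_one_mem l⟩
    let x : L' := V.unipotentOf hcp _ (V.shift_antitone hd1 hX)
    refine ⟨x, (mem_unipotentSeries hd1).mpr hX, fun a ha => ?_, fun g n i hn h => ?_⟩
    · rw [mul_inv_eq_iff_eq_mul]
      refine Subtype.ext (Units.ext ?_)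
      change LinearMap.prodMap T (transvection l) *
          LinearMap.prodMap (leftMul (ZMod p) L.series a) 1 =
        LinearMap.prodMap (leftMul (ZMod p) L.series (φ a)) 1 *
          LinearMap.prodMap T (transvection l)
      have hTa : T * leftMul (ZMod p) L.series a = leftMul (ZMod p) L.series (φ a) * T := by
        refine Submodule.linearMap_qext _ (LinearMap.ext fun u => ?_)
        simp only [LinearMap.comp_apply, Submodule.mkQ_apply, Module.End.mul_apply, leftMul_mk, hT]
        congr 1
        induction u using MonoidAlgebra.induction_on with
        | of g => rw [← map_mul, mapDomainLinearMap_of, mapDomainLinearMap_of, ← map_mul, hξ a ha]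
        | add u v hu hv => rw [mul_add, map_add, map_add, mul_add, hu, hv]
        | smul r u hu => rw [mul_smul_comm, map_smul, map_smul, mul_smul_comm, hu]
      have := congrArg (fun Y => LinearMap.prodMap Y (transvection (k := ZMod p) l)) hTa
      exact this
    · by_contra hi
      have h2 := (mem_unipotentSeries (by omega)).mp h
      have h4 := (mem_shift_of_prodMap_mul_pow h2).2
      rw [one_mul] at h4
      exact hi (transvection_pow_sub_one_mem hl h4 (by rwa [Ne, ZMod.natCast_eq_zero_iff]))

end DetectedGroup

/-- The map `f` restricts to a strict homomorphism on the subgroup `A`. -/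
structure NSeries.StrictOn {G H : Type*} [Group G] [Group H] {c : ℕ} (S : NSeries G c)
    (T : NSeries H c) (A : Subgroup G) (f : G → H) : Prop where
  map_mul : ∀ a ∈ A, ∀ b ∈ A, f (a * b) = f a * f b
  mem_iff : ∀ i, ∀ a ∈ A, f a ∈ T.P i ↔ a ∈ S.P i

namespace NSeries.StrictOn

variable {G H : Type*} [Group G] [Group H] {c : ℕ} {S : NSeries G c}
  {T : NSeries H c} {A : Subgroup G} {f : G → H}

lemma map_one (hf : S.StrictOn T A f) : f 1 = 1 := by
  have h := hf.map_mul 1 A.one_mem 1 A.one_mem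
  simpa using h

lemma map_inv (hf : S.StrictOn T A f) {a : G} (ha : a ∈ A) : f a⁻¹ = (f a)⁻¹ := by
  rw [eq_inv_iff_mul_eq_one, ← hf.map_mul _ (A.inv_mem ha) _ ha, inv_mul_cancel, hf.map_one]

lemma eq_one (hf : S.StrictOn T A f) {a : G} (ha : a ∈ A) (h : f a = 1) : a = 1 :=
  S.eq_one_of_mem le_rfl ((hf.mem_iff (c + 1) a ha).mp (h ▸ Subgroup.one_mem _))

lemma injOn (hf : S.StrictOn T A f) : Set.InjOn f A := by
  intro a ha b hb h
  rw [← mul_inv_eq_one]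
  refine hf.eq_one (A.mul_mem ha (A.inv_mem hb)) ?_
  rw [hf.map_mul a ha _ (A.inv_mem hb), hf.map_inv hb, h, mul_inv_cancel]

/-- The image of a subgroup under a map which is a strict homomorphism on it. -/
lemma exists_image (hf : S.StrictOn T A f) :
    ∃ B : Subgroup H, ∀ y, y ∈ B ↔ ∃ a ∈ A, f a = y :=
  ⟨{ carrier := f '' A
     one_mem' := ⟨1, A.one_mem, hf.map_one⟩
     mul_mem' := by
      rintro _ _ ⟨a, ha, rfl⟩ ⟨b, hb, rfl⟩
      exact ⟨a * b, A.mul_mem ha hb, hf.map_mul a ha b hb⟩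
     inv_mem' := by
      rintro _ ⟨a, ha, rfl⟩
      exact ⟨a⁻¹, A.inv_mem ha, hf.map_inv ha⟩ }, fun _ => Iff.rfl⟩

end NSeries.StrictOn

namespace DetectedGroup

variable {p c : ℕ} [Fact p.Prime]

theorem Realizes.exists_extension {L L' : DetectedGroup p c} {j : L →* L'} (hjr : Realizes L L' j)
    (hj : L.series.Strict L'.series j) {H : Type*} [Group H] (hexp : ∀ g : H, g ^ p = 1)
    {S : NSeries H c} {A : Subgroup H} (hA : A ≠ ⊤) {f : H → L} (hf : S.StrictOn L.series A f) :
    ∃ B, A < B ∧ ∃ f' : H → L', S.StrictOn L'.series B f' ∧ ∀ a ∈ A, f' a = j (f a) := by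
  classical
  have hp : p.Prime := Fact.out
  obtain ⟨k, x, hk1, hkc, hxk, hxA, hkA⟩ := S.exists_maximal_weight hA
  have hconj : ∀ a ∈ A, x * a * x⁻¹ ∈ A := fun a ha => NSeries.conj_mem hxk hkA ha
  obtain ⟨A', hA'⟩ := hf.exists_image
  let inv : L → H := Function.invFunOn f A
  have hinv : ∀ a ∈ A, inv (f a) = a := fun a ha => hf.injOn.leftInvOn_invFunOn ha
  obtain ⟨X, hXk, hXconj, hX⟩ := hjr A' (fun y => f (x * inv y * x⁻¹)) k hk1 hkc
    (by
      intro y hy z hz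
      obtain ⟨a, ha, rfl⟩ := (hA' y).mp hy
      obtain ⟨b, hb, rfl⟩ := (hA' z).mp hz
      rw [← hf.map_mul a ha b hb, hinv _ (A.mul_mem ha hb), hinv a ha, hinv b hb,
        ← hf.map_mul _ (hconj a ha) _ (hconj b hb)]
      congr 1
      group)
    (by
      intro y hy
      obtain ⟨a, ha, rfl⟩ := (hA' y).mp hy
      exact (hA' _).mpr ⟨_, hconj a ha, by rw [hinv a ha]⟩)
    (by
      intro i y hy hyi
      obtain ⟨a, ha, rfl⟩ := (hA' y).mp hy
      rw [hinv a ha, ← hf.map_inv ha, ← hf.map_mul _ (hconj a ha) _ (A.inv_mem ha),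
        hf.mem_iff _ _ (A.mul_mem (hconj a ha) (A.inv_mem ha)), add_comm]
      exact S.commutator_mem hxk ((hf.mem_iff _ a ha).mp hyi))
  have hXa : ∀ n : ℕ, ∀ a ∈ A, x ^ n * a * (x ^ n)⁻¹ ∈ A ∧
      X ^ n * j (f a) = j (f (x ^ n * a * (x ^ n)⁻¹)) * X ^ n := by
    intro n
    induction n with
    | zero => intro a ha; simpa using ha
    | succ n ih =>
      intro a ha
      obtain ⟨h1, h2⟩ := ih a ha
      have h3 := hXconj _ ((hA' _).mpr ⟨_, h1, rfl⟩)
      rw [hinv _ h1, mul_inv_eq_iff_eq_mul] at h3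
      have e : x ^ (n + 1) * a * (x ^ (n + 1))⁻¹ = x * (x ^ n * a * (x ^ n)⁻¹) * x⁻¹ := by
        rw [pow_succ']; group
      rw [e]
      exact ⟨hconj _ h1, by rw [pow_succ', mul_assoc, h2, ← mul_assoc, h3, mul_assoc]⟩
  have hdvd : ∀ {n : ℕ}, x ^ n ∈ A → x ^ n = 1 ∧ X ^ n = 1 := fun hn => by
    obtain ⟨m, rfl⟩ := dvd_of_pow_mem_of_notMem hp hxA (hexp x) hn
    simp [pow_mul, hexp, L'.pow_eq_one]
  have hwell' : ∀ a ∈ A, ∀ b ∈ A, ∀ n m : ℕ, n ≤ m → a * x ^ n = b * x ^ m →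
      j (f a) * X ^ n = j (f b) * X ^ m := by
    intro a ha b hb n m hnm h
    obtain ⟨d, rfl⟩ := Nat.exists_eq_add_of_le hnm
    rw [add_comm, pow_add, ← mul_assoc, mul_left_inj] at h
    have hd : x ^ d = b⁻¹ * a := by rw [h]; group
    obtain ⟨h1, h2⟩ := hdvd (hd ▸ A.mul_mem (A.inv_mem hb) ha)
    rw [pow_add, h2, mul_one, h, h1, mul_one]
  have hwell : ∀ a ∈ A, ∀ b ∈ A, ∀ n m : ℕ, a * x ^ n = b * x ^ m →
      j (f a) * X ^ n = j (f b) * X ^ m := by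
    intro a ha b hb n m h
    rcases le_total n m with hnm | hnm
    · exact hwell' a ha b hb n m hnm h
    · exact (hwell' b hb a ha m n hnm h.symm).symm
  have hex : ∀ h ∈ A ⊔ Subgroup.zpowers x, ∃ q : H × ℕ, q.1 ∈ A ∧ h = q.1 * x ^ q.2 := by
    intro h hh
    obtain ⟨m, hm, n, e⟩ := NSeries.exists_eq_mul_pow hp.ne_zero (hexp x) hxk hkA hh
    exact ⟨(m, n), hm, e⟩
  choose! q hqA hq using hex
  let f' : H → L' := fun h => j (f (q h).1) * X ^ (q h).2
  have hmemB : ∀ a ∈ A, ∀ n : ℕ, a * x ^ n ∈ A ⊔ Subgroup.zpowers x := fun a ha n =>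
    Subgroup.mul_mem_sup ha (Subgroup.npow_mem_zpowers x n)
  have hf' : ∀ a ∈ A, ∀ n : ℕ, f' (a * x ^ n) = j (f a) * X ^ n := fun a ha n =>
    hwell _ (hqA _ (hmemB a ha n)) a ha _ _ (hq _ (hmemB a ha n)).symm
  have hf'A : ∀ a ∈ A, f' a = j (f a) := fun a ha => by simpa using hf' a ha 0
  refine ⟨A ⊔ Subgroup.zpowers x, ?_, f', ⟨?_, ?_⟩, hf'A⟩
  · refine lt_of_le_of_ne le_sup_left fun h => hxA ?_
    rw [h]
    exact Subgroup.mem_sup_right (Subgroup.mem_zpowers x)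
  · intro g hg h hh
    obtain ⟨a, ha, n, rfl⟩ := NSeries.exists_eq_mul_pow hp.ne_zero (hexp x) hxk hkA hg
    obtain ⟨b, hb, m, rfl⟩ := NSeries.exists_eq_mul_pow hp.ne_zero (hexp x) hxk hkA hh
    obtain ⟨h1, h2⟩ := hXa n b hb
    have e : a * x ^ n * (b * x ^ m) = a * (x ^ n * b * (x ^ n)⁻¹) * x ^ (n + m) := by
      rw [pow_add]; group
    rw [e, hf' _ (A.mul_mem ha h1), hf' a ha, hf' b hb, hf.map_mul a ha _ h1, map_mul, pow_add,
      mul_assoc, ← mul_assoc _ (X ^ n), ← h2]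
    simp only [mul_assoc]
  · intro i h hh
    obtain ⟨a, ha, n, rfl⟩ := NSeries.exists_eq_mul_pow hp.ne_zero (hexp x) hxk hkA hh
    rw [hf' a ha]
    by_cases hn : p ∣ n
    · obtain ⟨m, rfl⟩ := hn
      simp only [pow_mul, hexp, L'.pow_eq_one, one_pow, mul_one]
      rw [hj, hf.mem_iff i a ha]
    · have hle : i ≤ k → (j (f a) * X ^ n ∈ L'.series.P i ↔ a * x ^ n ∈ S.P i) := fun hi => by
        rw [Subgroup.mul_mem_cancel_right _
            (Subgroup.pow_mem _ (L'.series.antitone hi hXk) n),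
          Subgroup.mul_mem_cancel_right _ (Subgroup.pow_mem _ (S.antitone hi hxk) n),
          hj, hf.mem_iff i a ha]
      rcases le_or_gt i k with hi | hi
      · exact hle hi
      · refine iff_of_false (fun h => absurd (hX _ n i hn h) (by omega)) fun h => hn ?_
        have h1 : a * x ^ n ∈ A := hkA (S.antitone hi h)
        exact dvd_of_pow_mem_of_notMem hp hxA (hexp x) ((Subgroup.mul_mem_cancel_left _ ha).mp h1)

end DetectedGroup

/-- The colimit of a sequence of injective group homomorphisms. -/
lemma exists_sequential_colimit (U : ℕ → Type) [∀ n, Group (U n)] (j : ∀ n, U n →* U (n + 1))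
    (hj : ∀ n, Function.Injective (j n)) :
    ∃ (Γ : Type) (_ : Group Γ) (ι : ∀ n, U n →* Γ), (∀ n, Function.Injective (ι n)) ∧
      (∀ n g, ι (n + 1) (j n g) = ι n g) ∧ ∀ γ, ∃ n g, ι n g = γ := by
  let f : ∀ i k, i ≤ k → (U i →* U k) := fun i k h =>
    Nat.leRec (motive := fun m _ => U i →* U m) (MonoidHom.id _) (fun k _ g => (j k).comp g) h
  have hself : ∀ i, f i i le_rfl = MonoidHom.id _ := fun i => Nat.leRec_self _ _
  have hsucc : ∀ i k (h : i ≤ k), f i (k + 1) (h.trans k.le_succ) = (j k).comp (f i k h) :=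
    fun i k h => Nat.leRec_succ _ _ _
  have : DirectedSystem U (f · · ·) :=
    { map_self := fun i x => by simp [hself]
      map_map := fun m k i hik hkm x => by
        induction m, hkm using Nat.le_induction with
        | base => simp [hself]
        | succ m hkm ih => rw [hsucc k m hkm, hsucc i m (hik.trans hkm)]; simp [ih] }
  have hinj : ∀ i k h, Function.Injective (f i k h) := by
    intro i k h
    induction k, h using Nat.le_induction with
    | base => rw [hself]; exact fun _ _ h => h
    | succ k h ih => rw [hsucc i k h]; exact (hj k).comp ih
  refine ⟨DirectLimit U f, inferInstance, fun n =>
    { toFun := fun g => ⟦⟨n, g⟩⟧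
      map_one' := (DirectLimit.one_def n).symm
      map_mul' := fun g h => (DirectLimit.mul_def n g h).symm }, ?_, ?_, ?_⟩
  · exact fun n => DirectLimit.mk_injective f hinj n
  · intro n g
    have h := DirectLimit.mk_apply (f := f) n (n + 1) g n.le_succ
    rw [hsucc n n le_rfl, hself] at h
    exact h
  · intro γ
    obtain ⟨n, g, rfl⟩ := DirectLimit.exists_eq_mk f γ
    exact ⟨n, g, rfl⟩

lemma NSeries.Strict.injective {G H : Type*} [Group G] [Group H] {c : ℕ} {S : NSeries G c}
    {T : NSeries H c} {f : G →* H} (hf : S.Strict T f) : Function.Injective f := by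
  rw [injective_iff_map_eq_one]
  intro g hg
  exact S.eq_one_of_mem le_rfl ((hf (c + 1) g).mp (hg ▸ Subgroup.one_mem _))

namespace DetectedGroup

variable {p c : ℕ} [Fact p.Prime]

theorem exists_tower (hcp : c < p) : ∃ (U : ℕ → DetectedGroup p c) (j : ∀ n, U n →* U (n + 1)),
    ∀ n, (U n).series.Strict (U (n + 1)).series (j n) ∧ Realizes (U n) (U (n + 1)) (j n) := by
  choose next j hj using exists_realizes (p := p) (c := c) hcp
  let trivialGroup : DetectedGroup p c :=
    { carrier := Unit
      pow_eq_one := fun _ => rfl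
      series :=
        { P := fun _ => ⊤
          antitone := fun _ _ _ => le_rfl
          one_eq_top := rfl
          succ_eq_bot := Subsingleton.elim _ _
          commutator_mem := fun _ _ => Subgroup.mem_top _ }
      detects := fun _ _ _ => Subgroup.mem_top _ }
  let U : ℕ → DetectedGroup p c := fun n => Nat.rec trivialGroup (fun _ L => next L) n
  exact ⟨U, fun n => j (U n), fun n => hj (U n)⟩

/-- A countable group of exponent `p` with a series, into which strict homomorphisms from
subgroups of finite groups extend. -/
theorem exists_homogeneous_group (hcp : c < p) : ∃ (Γ : Type) (_ : Group Γ) (T : NSeries Γ c),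
    Countable Γ ∧ (∀ g : Γ, g ^ p = 1) ∧
    ∀ (H : Type u) [Group H] [Finite H] (S : NSeries H c), (∀ g : H, g ^ p = 1) →
      ∀ (A : Subgroup H) (f : H → Γ), S.StrictOn T A f →
        ∃ g : H → Γ, S.StrictOn T ⊤ g ∧ ∀ a ∈ A, g a = f a := by
  obtain ⟨U, j, hj⟩ := exists_tower (p := p) hcp
  obtain ⟨Γ, _, ι, hinj, hcomp, hsurj⟩ :=
    exists_sequential_colimit (fun n => U n) j (fun n => (hj n).1.injective)
  have hlift : ∀ n m, n ≤ m → ∀ g : U n, ∃ h : U m, ι m h = ι n g ∧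
      ∀ i, h ∈ (U m).series.P i ↔ g ∈ (U n).series.P i := by
    intro n m hnm g
    induction m, hnm using Nat.le_induction with
    | base => exact ⟨g, rfl, fun _ => Iff.rfl⟩
    | succ m _ ih =>
      obtain ⟨h, h1, h2⟩ := ih
      exact ⟨j m h, (hcomp m h).trans h1, fun i => ((hj m).1 i h).trans (h2 i)⟩
  have hlift₂ : ∀ {n m} (g : U n) (h : U m), ∃ l, ∃ g' h' : U l, (ι l g' = ι n g ∧
      ∀ i, g' ∈ (U l).series.P i ↔ g ∈ (U n).series.P i) ∧ (ι l h' = ι m h ∧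
      ∀ i, h' ∈ (U l).series.P i ↔ h ∈ (U m).series.P i) := fun {n m} g h => by
    obtain ⟨g', hg'⟩ := hlift n _ (le_max_left n m) g
    obtain ⟨h', hh'⟩ := hlift m _ (le_max_right n m) h
    exact ⟨_, g', h', hg', hh'⟩
  let T : NSeries Γ c :=
    { P := fun i =>
        { carrier := {γ | ∃ n, ∃ g ∈ (U n).series.P i, ι n g = γ}
          one_mem' := ⟨0, 1, Subgroup.one_mem _, map_one _⟩
          mul_mem' := by
            rintro _ _ ⟨n, g, hg, rfl⟩ ⟨m, h, hh, rfl⟩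
            obtain ⟨l, g', h', ⟨e1, hg'⟩, e2, hh'⟩ := hlift₂ g h
            exact ⟨l, g' * h', mul_mem ((hg' i).mpr hg) ((hh' i).mpr hh),
              by rw [map_mul, e1, e2]⟩
          inv_mem' := by
            rintro _ ⟨n, g, hg, rfl⟩
            exact ⟨n, g⁻¹, inv_mem hg, map_inv _ _⟩ }
      antitone := by
        rintro i k hik _ ⟨n, g, hg, rfl⟩
        exact ⟨n, g, (U n).series.antitone hik hg, rfl⟩
      one_eq_top := by
        rw [eq_top_iff]
        intro γ _
        obtain ⟨n, g, rfl⟩ := hsurj γ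
        exact ⟨n, g, (U n).series.mem_one g, rfl⟩
      succ_eq_bot := by
        rw [eq_bot_iff]
        rintro _ ⟨n, g, hg, rfl⟩
        rw [(U n).series.eq_one_of_mem le_rfl hg, map_one]
        exact Subgroup.one_mem _
      commutator_mem := by
        rintro i k _ _ ⟨n, g, hg, rfl⟩ ⟨m, h, hh, rfl⟩
        obtain ⟨l, g', h', ⟨e1, hg'⟩, e2, hh'⟩ := hlift₂ g h
        exact ⟨l, _, (U l).series.commutator_mem ((hg' i).mpr hg) ((hh' k).mpr hh),
          by simp only [map_mul, map_inv, e1, e2]⟩ }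
  have hT : ∀ n, (U n).series.Strict T (ι n) := by
    intro n i g
    refine ⟨?_, fun hg => ⟨n, g, hg, rfl⟩⟩
    rintro ⟨m, h, hh, e⟩
    obtain ⟨l, g', h', ⟨e1, hg'⟩, e2, hh'⟩ := hlift₂ g h
    have : g' = h' := hinj l (by rw [e1, e2, e])
    rw [← hg', this, hh']
    exact hh
  refine ⟨Γ, ‹_›, T, ?_, ?_, ?_⟩
  · have hs : Function.Surjective (fun x : Σ n, U n => ι x.1 x.2) := fun γ => by
      obtain ⟨n, g, rfl⟩ := hsurj γ
      exact ⟨⟨n, g⟩, rfl⟩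
    exact hs.countable
  · intro γ
    obtain ⟨n, g, rfl⟩ := hsurj γ
    rw [← map_pow, (U n).pow_eq_one, map_one]
  · intro H _ _ S hexp A
    induction A using WellFoundedGT.induction with
    | ind A ih =>
      intro f hf
      by_cases hA : A = ⊤
      · subst hA
        exact ⟨f, hf, fun _ _ => rfl⟩
      choose n u hu using fun a => hsurj (f a)
      obtain ⟨N, hN⟩ : ∃ N, ∀ a, n a ≤ N := Finite.exists_le n
      choose v hv hvi using fun a => hlift (n a) N (hN a) (u a)
      have hvf : ∀ a, ι N (v a) = f a := fun a => (hv a).trans (hu a)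
      have hvs : S.StrictOn (U N).series A v :=
        { map_mul := fun a ha b hb => hinj N (by
            rw [map_mul, hvf, hvf, hvf, hf.map_mul a ha b hb])
          mem_iff := fun i a ha => by rw [← hT N, hvf, hf.mem_iff i a ha] }
      obtain ⟨B, hAB, f', hf', hff'⟩ := (hj N).2.exists_extension (hj N).1 hexp hA hvs
      obtain ⟨g, hg, hgf⟩ := ih B hAB (fun b => ι (N + 1) (f' b))
        { map_mul := fun a ha b hb => by rw [hf'.map_mul a ha b hb, map_mul]
          mem_iff := fun i a ha => by rw [hT (N + 1), hf'.mem_iff i a ha] }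
      exact ⟨g, hg, fun a ha => by rw [hgf a (hAB.le ha), hff' a ha, hcomp, hvf]⟩

end DetectedGroup

section LowerCentralSeries

variable {G : Type*} [Group G]

/-- The three subgroups lemma modulo a normal subgroup. -/
lemma commutator_commutator_le_of_rotate {H₁ H₂ H₃ N : Subgroup G} [N.Normal]
    (h1 : ⁅⁅H₂, H₃⁆, H₁⁆ ≤ N) (h2 : ⁅⁅H₃, H₁⁆, H₂⁆ ≤ N) : ⁅⁅H₁, H₂⁆, H₃⁆ ≤ N := by
  have key : ∀ A B C : Subgroup G, ⁅⁅A, B⁆, C⁆ ≤ N ↔ ⁅⁅A.map (QuotientGroup.mk' N),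
      B.map (QuotientGroup.mk' N)⁆, C.map (QuotientGroup.mk' N)⁆ = ⊥ := fun A B C => by
    rw [← Subgroup.map_commutator, ← Subgroup.map_commutator, Subgroup.map_eq_bot_iff,
      QuotientGroup.ker_mk']
  rw [key] at *
  exact Subgroup.commutator_commutator_eq_bot_of_rotate h1 h2

lemma commutator_lowerCentralSeries_le (m n : ℕ) :
    ⁅(⊤ : Subgroup G).lowerCentralSeries m, (⊤ : Subgroup G).lowerCentralSeries n⁆ ≤
      (⊤ : Subgroup G).lowerCentralSeries (m + n + 1) := by
  induction n generalizing m with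
  | zero => exact le_rfl
  | succ n ih =>
    rw [Subgroup.lowerCentralSeries_succ _ n, Subgroup.commutator_comm]
    refine commutator_commutator_le_of_rotate ?_ ?_
    · rw [Subgroup.commutator_comm ⊤]
      refine (ih (m + 1)).trans (le_of_eq ?_)
      congr 1
      omega
    · exact Subgroup.commutator_mono (ih m) le_rfl

/-- The lower central series as an `NSeries`. -/
def NSeries.ofLowerCentralSeries {c : ℕ} (h : (⊤ : Subgroup G).lowerCentralSeries c = ⊥) :
    NSeries G c where
  P i := (⊤ : Subgroup G).lowerCentralSeries (i - 1)
  antitone i j hij := Subgroup.lowerCentralSeries_antitone _ (Nat.sub_le_sub_right hij 1)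
  one_eq_top := rfl
  succ_eq_bot := h
  commutator_mem {i j x y} hx hy :=
    Subgroup.lowerCentralSeries_antitone _ (by omega)
      (commutator_lowerCentralSeries_le _ _ (Subgroup.commutator_mem_commutator hx hy))

/-- The restriction of an `NSeries` along an injective homomorphism. -/
def NSeries.comap {H : Type*} [Group H] {c : ℕ} (S : NSeries H c) (f : G →* H)
    (hf : Function.Injective f) : NSeries G c where
  P i := (S.P i).comap f
  antitone _ _ h := Subgroup.comap_mono (S.antitone h)
  one_eq_top := by rw [S.one_eq_top, Subgroup.comap_top]
  succ_eq_bot := by rw [S.succ_eq_bot, MonoidHom.comap_bot, (MonoidHom.ker_eq_bot_iff f).mpr hf]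
  commutator_mem hx hy := by simpa using S.commutator_mem hx hy

end LowerCentralSeries

/-- Finitely generated nilpotent torsion groups are finite. -/
lemma finite_of_isNilpotent_of_fg (G : Type*) [Group G] [Group.IsNilpotent G] :
    IsMulTorsion G → Group.FG G → Finite G := by
  refine Group.nilpotent_center_quotient_ind
    (P := fun G _ _ => IsMulTorsion G → Group.FG G → Finite G) G ?_ ?_
  · intros; infer_instance
  · intro G _ _ ih ht hfg
    have : Finite (G ⧸ Subgroup.center G) :=
      ih (ht.of_surjective (QuotientGroup.mk'_surjective _)) inferInstance
    have : (Subgroup.center G).FiniteIndex := Subgroup.finiteIndex_of_finite_quotient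
    let : CommGroup (Subgroup.center G) :=
      { (inferInstance : Group (Subgroup.center G)) with
        mul_comm := fun a b => Subtype.ext ((Subgroup.mem_center_iff.mp b.2 a)) }
    have : Finite (Subgroup.center G) := CommGroup.finite_of_fg_isMulTorsion _ (ht.subgroup _)
    exact Finite.of_equiv _ (Subgroup.groupEquivQuotientProdSubgroup (s := Subgroup.center G)).symm

section Embedding

variable {Γ : Type*} [Group Γ] {c p : ℕ} {T : NSeries Γ c}

/-- If strict homomorphisms extend from subgroups of finite groups, then locally finite groups
embed. -/
lemma exists_injective_of_extension
    (hext : ∀ (H : Type u) [Group H] [Finite H] (S : NSeries H c), (∀ g : H, g ^ p = 1) →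
      ∀ (A : Subgroup H) (f : H → Γ), S.StrictOn T A f →
        ∃ g : H → Γ, S.StrictOn T ⊤ g ∧ ∀ a ∈ A, g a = f a)
    (G : Type u) [Group G] [Countable G] (hexp : ∀ g : G, g ^ p = 1) (S : NSeries G c)
    (hfin : ∀ s : Set G, s.Finite → Finite (Subgroup.closure s)) :
    ∃ f : G →* Γ, Function.Injective f := by
  classical
  have hstep : ∀ A B : Subgroup G, A ≤ B → Finite B → ∀ f : G → Γ, S.StrictOn T A f →
      ∃ g : G → Γ, S.StrictOn T B g ∧ ∀ a ∈ A, g a = f a := by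
    intro A B hAB _ f hf
    obtain ⟨g, hg, hgf⟩ := hext B (S.comap B.subtype B.subtype_injective)
      (fun b => Subtype.ext (hexp b)) (A.subgroupOf B) (fun b => f b)
      ⟨fun a ha b hb => hf.map_mul a ha b hb, fun i a ha => hf.mem_iff i a ha⟩
    refine ⟨fun x => if hx : x ∈ B then g ⟨x, hx⟩ else 1, ⟨fun a ha b hb => ?_,
      fun i a ha => ?_⟩, fun a ha => ?_⟩
    · simp only [ha, hb, B.mul_mem ha hb, dif_pos]
      exact hg.map_mul ⟨a, ha⟩ trivial ⟨b, hb⟩ trivial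
    · simp only [ha, dif_pos]
      exact hg.mem_iff i ⟨a, ha⟩ trivial
    · simp only [hAB ha, dif_pos]
      exact hgf ⟨a, hAB ha⟩ ha
  obtain ⟨e, he⟩ := exists_surjective_nat G
  let K : ℕ → Subgroup G := fun s => Subgroup.closure (e '' Set.Iio s)
  have hK : Monotone K := fun s t h =>
    Subgroup.closure_mono (Set.image_mono (Set.Iio_subset_Iio h))
  have hKfin : ∀ s, Finite (K s) := fun s => hfin _ ((Set.finite_Iio s).image e)
  have hKe : ∀ x, ∃ s, x ∈ K s := fun x => by
    obtain ⟨n, rfl⟩ := he x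
    exact ⟨n + 1, Subgroup.subset_closure ⟨n, Nat.lt_succ_self n, rfl⟩⟩
  have h0 : S.StrictOn T (K 0) (fun _ => 1) := by
    have : K 0 = ⊥ := by simp [K]
    rw [this]
    refine ⟨fun _ _ _ _ => (mul_one 1).symm, fun i a ha => ?_⟩
    rw [Subgroup.mem_bot.mp ha]
    exact iff_of_true (Subgroup.one_mem _) (Subgroup.one_mem _)
  have hnext : ∀ s (f : {f : G → Γ // S.StrictOn T (K s) f}),
      ∃ g : {g : G → Γ // S.StrictOn T (K (s + 1)) g}, ∀ a ∈ K s, g.1 a = f.1 a := fun s f => by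
    obtain ⟨g, hg, hgf⟩ := hstep _ _ (hK s.le_succ) (hKfin _) f.1 f.2
    exact ⟨⟨g, hg⟩, hgf⟩
  choose next hnext using hnext
  let F : ∀ s, {f : G → Γ // S.StrictOn T (K s) f} := fun s => Nat.rec ⟨_, h0⟩ next s
  have hF : ∀ s t, s ≤ t → ∀ a ∈ K s, (F t).1 a = (F s).1 a := by
    intro s t hst a ha
    induction t, hst using Nat.le_induction with
    | base => rfl
    | succ t hst ih => exact (hnext t (F t) a (hK hst ha)).trans ih
  choose n hn using hKe
  have hφ : ∀ s, ∀ a ∈ K s, (F (n a)).1 a = (F s).1 a := fun s a ha => by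
    rw [← hF _ _ (le_max_left (n a) s) a (hn a), hF _ _ (le_max_right (n a) s) a ha]
  have hcommon : ∀ a b, ∃ s, a ∈ K s ∧ b ∈ K s := fun a b =>
    ⟨max (n a) (n b), hK (le_max_left _ _) (hn a), hK (le_max_right _ _) (hn b)⟩
  refine ⟨MonoidHom.mk' (fun a => (F (n a)).1 a) fun a b => ?_, fun a b hab => ?_⟩
  · obtain ⟨s, ha, hb⟩ := hcommon a b
    rw [hφ s a ha, hφ s b hb, hφ s _ (mul_mem ha hb), (F s).2.map_mul a ha b hb]
  · obtain ⟨s, ha, hb⟩ := hcommon a b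
    refine (F s).2.injOn ha hb ?_
    rw [← hφ s a ha, ← hφ s b hb]
    exact hab

end Embedding

/-- for a prime `p` and `0 < c < p` there is a countable group `G₀` of
exponent dividing `p` and nilpotency class at most `c` (its lower central series
reaches the trivial subgroup after `c` steps) into which every at most countable
group of exponent dividing `p` and nilpotency class at most `c` embeds. -/
theorem exists_universal_nilpotent_exponent_p_group (p c : ℕ) (hp : p.Prime)
    (hc : 0 < c) (hcp : c < p) :
    ∃ (G₀ : Type u) (_ : Group G₀), Countable G₀ ∧ (∀ g : G₀, g ^ p = 1) ∧
      Subgroup.lowerCentralSeries (⊤ : Subgroup G₀) c = ⊥ ∧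
      ∀ (G : Type u) [Group G] [Countable G], (∀ g : G, g ^ p = 1) →
        Subgroup.lowerCentralSeries (⊤ : Subgroup G) c = ⊥ →
        ∃ f : G →* G₀, Function.Injective f := by
  have : Fact p.Prime := ⟨hp⟩
  obtain ⟨Γ, _, T, _, hexp, hext⟩ :=
    DetectedGroup.exists_homogeneous_group.{u} (p := p) (c := c) hcp
  refine ⟨ULift.{u} Γ, inferInstance, inferInstance, fun g => ULift.ext _ _ (hexp g.down),
    (T.comap (MulEquiv.ulift : ULift.{u} Γ ≃* Γ).toMonoidHom
      MulEquiv.ulift.injective).lowerCentralSeries_eq_bot, ?_⟩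
  intro G _ _ hG hGc
  have : Group.IsNilpotent G :=
    Subgroup.nilpotent_iff_lowerCentralSeries.mpr ⟨c, hGc⟩
  have hfin : ∀ s : Set G, s.Finite → Finite (Subgroup.closure s) := fun s hs =>
    have := hs.to_subtype
    finite_of_isNilpotent_of_fg _ (fun g => isOfFinOrder_iff_pow_eq_one.mpr
      ⟨p, hp.pos, Subtype.ext (hG g)⟩) inferInstance
  obtain ⟨f, hf⟩ :=
    exists_injective_of_extension hext G hG (NSeries.ofLowerCentralSeries hGc) hfin
  exact ⟨(MulEquiv.ulift : ULift.{u} Γ ≃* Γ).symm.toMonoidHom.comp f,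
    MulEquiv.ulift.symm.injective.comp hf⟩
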